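/- Let (p,q) be a pair of nonzero integers. Then the group G_{p,q} is bi-orderable if and only if it admits no generalized torsion elements. -/

import Mathlib

/-- The set of conjugates `h⁻¹ * g * h` of an element `g` of a group. -/
def conjSet {G : Type*} [Group G] (g : G) : Set G := {x | ∃ h : G, x = h⁻¹ * g * h}

/-- `<<g>>^+`: the subsemigroup generated by all conjugates of `g`. -/
def ggP {G : Type*} [Group G] (g : G) : Subsemigroup G := Subsemigroup.closure (conjSet g)

/-- A generalized torsion element: a nontrivial element `g` with `1 ∈ <<g>>^+`. -/
def IsGenTorsionElem {G : Type*} [Group G] (g : G) : Prop := g ≠ 1 ∧ (1 : G) ∈ ggP g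

/-- `G` admits a generalized torsion element. -/
def HasGenTorsion (G : Type*) [Group G] : Prop := ∃ g : G, IsGenTorsionElem g

/-- The relators of the presentation
`< a, b, t | t a^p t⁻¹ = b⁻¹ a^p, t b^{-q} a⁻¹ t⁻¹ = b^{-q}, [b^q, a^p] = 1 >`,
where `a`, `b`, `t` are the generators `0`, `1`, `2` respectively, and
`[g,h] = g⁻¹ h⁻¹ g h`. -/
def gpqRels (p q : ℤ) : Set (FreeGroup (Fin 3)) :=
  let a : FreeGroup (Fin 3) := FreeGroup.of 0
  let b : FreeGroup (Fin 3) := FreeGroup.of 1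
  let t : FreeGroup (Fin 3) := FreeGroup.of 2
  { t * a ^ p * t⁻¹ * (b⁻¹ * a ^ p)⁻¹,
    t * b ^ (-q) * a⁻¹ * t⁻¹ * (b ^ (-q))⁻¹,
    (b ^ q)⁻¹ * (a ^ p)⁻¹ * b ^ q * a ^ p }

/-- `G_{p,q}`, the fundamental group of the 3-manifold obtained by 0-surgery along the
double twist knot `K_{p,q}`. -/
abbrev Gpq (p q : ℤ) := PresentedGroup (gpqRels p q)

/-- `G` is bi-orderable: it admits a strict total order invariant under left and right
multiplication. -/
def IsBiOrderable (G : Type*) [Group G] : Prop :=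
  ∃ r : G → G → Prop, IsStrictTotalOrder G r ∧
    ∀ a b g h : G, r g h → r (a * g * b) (a * h * b)

section GenTorsion

variable {G : Type*} [Group G]

lemma self_mem_ggP (g : G) : g ∈ ggP g := Subsemigroup.subset_closure ⟨1, by simp⟩

lemma conj_mem_ggP {g x : G} (hx : x ∈ ggP g) (h : G) : h⁻¹ * x * h ∈ ggP g := by
  induction hx using Subsemigroup.closure_induction with
  | mem x hx =>
    obtain ⟨k, rfl⟩ := hx
    exact Subsemigroup.subset_closure ⟨k * h, by group⟩
  | mul x y _ _ hx hy =>
    convert mul_mem hx hy using 1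
    group

lemma ggP_le {g : G} {P : Subsemigroup G} (hg : g ∈ P)
    (hP : ∀ x ∈ P, ∀ h : G, h⁻¹ * x * h ∈ P) : ggP g ≤ P := by
  refine Subsemigroup.closure_le.2 ?_
  rintro _ ⟨h, rfl⟩
  exact hP g hg h

lemma inv_mem_ggP_inv {g x : G} (hx : x ∈ ggP g) : x⁻¹ ∈ ggP g⁻¹ := by
  induction hx using Subsemigroup.closure_induction with
  | mem x hx =>
    obtain ⟨k, rfl⟩ := hx
    exact Subsemigroup.subset_closure ⟨k, by group⟩
  | mul x y _ _ hx hy =>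
    convert conj_mem_ggP (mul_mem hy hx) 1 using 1
    group

lemma one_notMem_ggP (hG : ¬ HasGenTorsion G) {g : G} (hg : g ≠ 1) : (1 : G) ∉ ggP g :=
  fun h => hG ⟨g, hg, h⟩

theorem IsBiOrderable.not_hasGenTorsion (hG : IsBiOrderable G) : ¬ HasGenTorsion G := by
  obtain ⟨r, hr, hmul⟩ := hG
  have pos : ∀ g : G, r 1 g → (1 : G) ∉ ggP g := by
    intro g hg h1
    let P : Subsemigroup G :=
      { carrier := {x | r 1 x}
        mul_mem' := fun {x y} hx hy => _root_.trans hx (by simpa using hmul x 1 1 y hy) }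
    have hP : ggP g ≤ P := ggP_le hg fun x hx h => show r 1 (h⁻¹ * x * h) by
      simpa using hmul h⁻¹ h 1 x hx
    exact irrefl (r := r) 1 (hP h1)
  rintro ⟨g, hg, h1⟩
  rcases trichotomous_of r 1 g with h | h | h
  · exact pos g h h1
  · exact hg h.symm
  · refine pos g⁻¹ (by simpa using hmul g⁻¹ 1 g 1 h) ?_
    simpa using inv_mem_ggP_inv h1

/-- Roots are unique in a group without generalized torsion. -/
lemma eq_of_pow_eq_pow (hG : ¬ HasGenTorsion G) {g k : G} {n : ℕ} (hn : n ≠ 0)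
    (h : g ^ n = k ^ n) : g = k := by
  have key : ∀ m : ℕ, (g ^ (m + 1))⁻¹ * k ^ (m + 1) ∈ ggP (g⁻¹ * k) := by
    intro m
    induction m with
    | zero => simpa using self_mem_ggP (g⁻¹ * k)
    | succ m ih =>
      convert mul_mem (conj_mem_ggP ih g) (self_mem_ggP (g⁻¹ * k)) using 1
      rw [pow_succ g (m + 1), pow_succ k (m + 1)]
      group
  obtain ⟨m, rfl⟩ := Nat.exists_eq_succ_of_ne_zero hn
  by_contra hne
  refine one_notMem_ggP hG (g := g⁻¹ * k) (fun h' => hne (inv_mul_eq_one.1 h')) ?_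
  simpa [Nat.succ_eq_add_one, h] using key m

lemma commute_of_zpow_left (hG : ¬ HasGenTorsion G) {g h : G} {n : ℤ} (hn : n ≠ 0)
    (hc : Commute (g ^ n) h) : Commute g h := by
  have hc' : Commute (g ^ n.natAbs) h := by
    rcases Int.natAbs_eq n with h' | h'
    · rw [h', zpow_natCast] at hc
      exact hc
    · rw [h', zpow_neg, zpow_natCast] at hc
      simpa using hc.inv_left
  have : g = h⁻¹ * g * h := by
    refine eq_of_pow_eq_pow hG (Int.natAbs_ne_zero.2 hn) ?_
    have := conj_pow (i := n.natAbs) (a := h⁻¹) (b := g)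
    rw [inv_inv] at this
    rw [this, mul_assoc, hc'.eq, inv_mul_cancel_left]
  calc g * h = h * (h⁻¹ * g * h) := by group
    _ = h * g := by rw [← this]

lemma commute_of_zpow_zpow (hG : ¬ HasGenTorsion G) {g h : G} {m n : ℤ} (hm : m ≠ 0)
    (hn : n ≠ 0) (hc : Commute (g ^ m) (h ^ n)) : Commute g h :=
  (commute_of_zpow_left hG hn (commute_of_zpow_left hG hm hc).symm).symm

/-- The pointwise products of conjugations, as functions `G → G`. -/
def conjProducts (G : Type*) [Group G] : Subsemigroup (G → G) :=
  Subsemigroup.closure (Set.range fun h x => h⁻¹ * x * h)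

lemma conjProducts_apply_mem {F : G → G} (hF : F ∈ conjProducts G) {P : Subsemigroup G}
    (hP : ∀ x ∈ P, ∀ h : G, h⁻¹ * x * h ∈ P) {x : G} (hx : x ∈ P) : F x ∈ P := by
  induction hF using Subsemigroup.closure_induction with
  | mem F hF =>
    obtain ⟨h, rfl⟩ := hF
    exact hP x hx h
  | mul F F' _ _ h h' => exact mul_mem h h'

lemma exists_conjProducts_of_mem_ggP {x u : G} (hu : u ∈ ggP x) :
    ∃ F ∈ conjProducts G, F x = u := by
  induction hu using Subsemigroup.closure_induction with
  | mem u hu =>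
    obtain ⟨h, rfl⟩ := hu
    exact ⟨_, Subsemigroup.subset_closure ⟨h, rfl⟩, rfl⟩
  | mul u v _ _ hu hv =>
    obtain ⟨F, hF, rfl⟩ := hu
    obtain ⟨F', hF', rfl⟩ := hv
    exact ⟨F * F', mul_mem hF hF', rfl⟩

section Metabelian

variable {N : Subgroup G} [hN : N.Normal]

lemma conjProducts_apply_mem_normal {F : G → G} (hF : F ∈ conjProducts G) {x : G}
    (hx : x ∈ N) : F x ∈ N :=
  conjProducts_apply_mem (P := N.toSubmonoid.toSubsemigroup) hF
    (fun y hy h => by simpa using hN.conj_mem y hy h⁻¹) hx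

lemma conjProducts_map_mul (hcomm : ∀ x ∈ N, ∀ y ∈ N, x * y = y * x) {F : G → G}
    (hF : F ∈ conjProducts G) {x y : G} (hx : x ∈ N) (hy : y ∈ N) :
    F (x * y) = F x * F y := by
  induction hF using Subsemigroup.closure_induction with
  | mem F hF =>
    obtain ⟨h, rfl⟩ := hF
    group
  | mul F F' hF hF' h h' =>
    simp only [Pi.mul_apply, h, h']
    have := hcomm _ (conjProducts_apply_mem_normal hF hy) _ (conjProducts_apply_mem_normal hF' hx)
    simp only [mul_assoc]
    rw [← mul_assoc (F y), this, mul_assoc]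

lemma conjProducts_map_inv (hcomm : ∀ x ∈ N, ∀ y ∈ N, x * y = y * x) {F : G → G}
    (hF : F ∈ conjProducts G) {x : G} (hx : x ∈ N) : F x⁻¹ = (F x)⁻¹ := by
  have h1 := conjProducts_map_mul hcomm hF N.one_mem N.one_mem
  rw [mul_one, left_eq_mul] at h1
  rw [eq_inv_iff_mul_eq_one, ← conjProducts_map_mul hcomm hF (N.inv_mem hx) hx, inv_mul_cancel, h1]

lemma conjProducts_comm (hcomm : ∀ x ∈ N, ∀ y ∈ N, x * y = y * x)
    (hquot : ∀ g h : G, g⁻¹ * h⁻¹ * g * h ∈ N) {F F' : G → G}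
    (hF : F ∈ conjProducts G) (hF' : F' ∈ conjProducts G) {x : G} (hx : x ∈ N) :
    F (F' x) = F' (F x) := by
  induction hF using Subsemigroup.closure_induction with
  | mem F hF =>
    obtain ⟨h, rfl⟩ := hF
    induction hF' using Subsemigroup.closure_induction with
    | mem F' hF' =>
      obtain ⟨k, rfl⟩ := hF'
      have h1 := hcomm _ (hN.conj_mem x hx (k * h)⁻¹) _ (hquot k h)
      calc h⁻¹ * (k⁻¹ * x * k) * h
          = ((k * h)⁻¹ * x * (k * h)) * (k⁻¹ * h⁻¹ * k * h) * (k⁻¹ * h⁻¹ * k * h)⁻¹ := by group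
        _ = (k⁻¹ * h⁻¹ * k * h) * ((k * h)⁻¹ * x * (k * h)) * (k⁻¹ * h⁻¹ * k * h)⁻¹ := by
          rw [inv_inv] at h1
          rw [h1]
        _ = k⁻¹ * (h⁻¹ * x * h) * k := by group
    | mul F₁ F₂ _ _ h₁ h₂ =>
      simp only [Pi.mul_apply] at h₁ h₂ ⊢
      rw [← h₁, ← h₂]
      group
  | mul F₁ F₂ _ _ h₁ h₂ =>
    rw [Pi.mul_apply, Pi.mul_apply, h₁, h₂, conjProducts_map_mul hcomm hF'] <;>
      exact conjProducts_apply_mem_normal ‹_› hx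

/-- If `N` is abelian with abelian quotient, and `G` has no generalized torsion, then `N` is
ordered by a positive cone invariant under conjugation in `G`. -/
lemma exists_conj_invariant_cone (hG : ¬ HasGenTorsion G)
    (hcomm : ∀ x ∈ N, ∀ y ∈ N, x * y = y * x) (hquot : ∀ g h : G, g⁻¹ * h⁻¹ * g * h ∈ N) :
    ∃ P : Subsemigroup G, (1 : G) ∉ P ∧ (∀ x ∈ P, ∀ h : G, h⁻¹ * x * h ∈ P) ∧
      ∀ x ∈ N, x ≠ 1 → x ∈ P ∨ x⁻¹ ∈ P := by
  let S : Set (Subsemigroup G) :=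
    {P | (1 : G) ∉ P ∧ (∀ x ∈ P, ∀ h : G, h⁻¹ * x * h ∈ P) ∧ ∀ x ∈ P, x ∈ N}
  obtain ⟨P, -, hPmax⟩ := zorn_le_nonempty₀ S (fun c hcS hc P₀ hP₀ => by
    have hmem : ∀ x, x ∈ sSup c ↔ ∃ P ∈ c, x ∈ P := fun x =>
      Subsemigroup.mem_sSup_of_directed_on hc.directedOn
    refine ⟨sSup c, ⟨?_, ?_, ?_⟩, fun P hP => le_sSup hP⟩
    · rw [hmem]
      rintro ⟨P, hP, h1⟩
      exact (hcS hP).1 h1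
    · intro x hx h
      obtain ⟨P, hP, hxP⟩ := (hmem x).1 hx
      exact (hmem _).2 ⟨P, hP, (hcS hP).2.1 x hxP h⟩
    · intro x hx
      obtain ⟨P, hP, hxP⟩ := (hmem x).1 hx
      exact (hcS hP).2.2 x hxP) ⊥
    ⟨Subsemigroup.notMem_bot, fun x hx => (Subsemigroup.notMem_bot hx).elim,
      fun x hx => (Subsemigroup.notMem_bot hx).elim⟩
  obtain ⟨hP1, hPconj, hPN⟩ := hPmax.prop
  refine ⟨P, hP1, hPconj, ?_⟩
  have extend : ∀ x ∈ N, x ≠ 1 → x ∉ P → ∃ u ∈ ggP x, u⁻¹ ∈ P := by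
    intro x hxN hx1 hxP
    by_contra! hcon
    have hgN : ∀ u ∈ ggP x, u ∈ N := fun u hu =>
      ggP_le (P := N.toSubmonoid.toSubsemigroup) hxN
        (fun y hy h => by simpa using hN.conj_mem y hy h⁻¹) hu
    let Q : Subsemigroup G :=
      { carrier := {y | y ∈ P ∨ y ∈ ggP x ∨ ∃ z ∈ P, ∃ u ∈ ggP x, y = z * u}
        mul_mem' := by
          rintro y y' (hy | hy | ⟨z, hz, u, hu, rfl⟩) (hy' | hy' | ⟨z', hz', u', hu', rfl⟩)
          · exact .inl (mul_mem hy hy')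
          · exact .inr (.inr ⟨y, hy, y', hy', rfl⟩)
          · exact .inr (.inr ⟨y * z', mul_mem hy hz', u', hu', by group⟩)
          · exact .inr (.inr ⟨y', hy', y, hy, hcomm _ (hgN _ hy) _ (hPN _ hy')⟩)
          · exact .inr (.inl (mul_mem hy hy'))
          · refine .inr (.inr ⟨z', hz', y * u', mul_mem hy hu', ?_⟩)
            rw [← mul_assoc, hcomm _ (hgN _ hy) _ (hPN _ hz'), mul_assoc]
          · refine .inr (.inr ⟨z * y', mul_mem hz hy', u, hu, ?_⟩)
            rw [mul_assoc, hcomm _ (hgN _ hu) _ (hPN _ hy'), mul_assoc]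
          · exact .inr (.inr ⟨z, hz, u * y', mul_mem hu hy', by group⟩)
          · refine .inr (.inr ⟨z * z', mul_mem hz hz', u * u', mul_mem hu hu', ?_⟩)
            rw [mul_assoc, ← mul_assoc u, hcomm _ (hgN _ hu) _ (hPN _ hz')]
            group }
    have hQ : Q ∈ S := by
      refine ⟨?_, ?_, ?_⟩
      · rintro (h | h | ⟨z, hz, u, hu, h⟩)
        · exact hP1 h
        · exact one_notMem_ggP hG hx1 h
        · exact hcon u hu (by rwa [← eq_inv_of_mul_eq_one_left h.symm])
      · rintro y (hy | hy | ⟨z, hz, u, hu, rfl⟩) h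
        · exact .inl (hPconj y hy h)
        · exact .inr (.inl (conj_mem_ggP hy h))
        · exact .inr (.inr ⟨_, hPconj z hz h, _, conj_mem_ggP hu h, by group⟩)
      · rintro y (hy | hy | ⟨z, hz, u, hu, rfl⟩)
        · exact hPN y hy
        · exact hgN y hy
        · exact N.mul_mem (hPN z hz) (hgN u hu)
    exact hxP (hPmax.le_of_ge hQ (fun y hy => .inl hy) (.inr (.inl (self_mem_ggP x))))
  intro x hxN hx1
  by_contra! hx
  obtain ⟨u, hu, huP⟩ := extend x hxN hx1 hx.1
  obtain ⟨v, hv, hvP⟩ := extend x⁻¹ (N.inv_mem hxN) (inv_ne_one.2 hx1) hx.2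
  obtain ⟨F, hF, rfl⟩ := exists_conjProducts_of_mem_ggP hu
  obtain ⟨F', hF', rfl⟩ := exists_conjProducts_of_mem_ggP hv
  have h₁ := conjProducts_apply_mem hF' hPconj huP
  have h₂ := conjProducts_apply_mem hF hPconj hvP
  rw [conjProducts_map_inv hcomm hF' (conjProducts_apply_mem_normal hF hxN)] at h₁
  rw [conjProducts_map_inv hcomm hF' hxN, inv_inv, conjProducts_comm hcomm hquot hF hF' hxN] at h₂
  exact hP1 (by simpa using mul_mem h₁ h₂)

end Metabelian

/-- A group without generalized torsion that maps to an ordered abelian group with abelian kernel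
is bi-orderable. -/
theorem isBiOrderable_of_ker_comm {A : Type*} [CommGroup A] [LinearOrder A] [IsOrderedMonoid A]
    (hG : ¬ HasGenTorsion G) (φ : G →* A)
    (hcomm : ∀ x ∈ φ.ker, ∀ y ∈ φ.ker, x * y = y * x) : IsBiOrderable G := by
  obtain ⟨P, hP1, hPconj, hPtot⟩ := exists_conj_invariant_cone hG hcomm fun g h => by
    simp [MonoidHom.mem_ker, mul_comm]
  refine ⟨fun g h => φ g < φ h ∨ φ g = φ h ∧ g⁻¹ * h ∈ P,
    { trichotomous := ?_, irrefl := ?_, trans := ?_ }, ?_⟩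
  · intro g h h₁ h₂
    push Not at h₁ h₂
    have heq : φ g = φ h := le_antisymm h₂.1 h₁.1
    by_contra hne
    rcases hPtot (g⁻¹ * h) (by simp [MonoidHom.mem_ker, heq])
      (fun h' => hne (inv_mul_eq_one.1 h')) with hP | hP
    · exact h₁.2 heq hP
    · exact h₂.2 heq.symm (by simpa using hP)
  · rintro g (h | ⟨-, h⟩)
    · exact lt_irrefl _ h
    · exact hP1 (by simpa using h)
  · rintro g h k (h₁ | ⟨h₁, h₁'⟩) (h₂ | ⟨h₂, h₂'⟩)
    · exact .inl (h₁.trans h₂)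
    · exact .inl (h₂ ▸ h₁)
    · exact .inl (h₁ ▸ h₂)
    · exact .inr ⟨h₁.trans h₂, by simpa [mul_assoc] using mul_mem h₁' h₂'⟩
  · rintro a b g h (h₁ | ⟨h₁, h₁'⟩)
    · exact .inl (by simpa using h₁)
    · refine .inr ⟨by simp [h₁], ?_⟩
      convert hPconj _ h₁' b using 1
      group

/-- The elements with a nontrivial power in the abelian subgroup `H`; in a group without
generalized torsion they form a subgroup. -/
def isolator (hG : ¬ HasGenTorsion G) (H : Subgroup G) (hH : ∀ x ∈ H, ∀ y ∈ H, x * y = y * x) :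
    Subgroup G where
  carrier := {g | ∃ n : ℤ, n ≠ 0 ∧ g ^ n ∈ H}
  one_mem' := ⟨1, one_ne_zero, by simp⟩
  inv_mem' := by
    rintro g ⟨n, hn, h⟩
    exact ⟨n, hn, by simpa using h⟩
  mul_mem' := by
    rintro g k ⟨m, hm, hg⟩ ⟨n, hn, hk⟩
    refine ⟨m * n, mul_ne_zero hm hn, ?_⟩
    rw [(commute_of_zpow_zpow hG hm hn (hH _ hg _ hk)).mul_zpow, zpow_mul, mul_comm m, zpow_mul]
    exact H.mul_mem (H.zpow_mem hg _) (H.zpow_mem hk _)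

section Isolator

variable {hG : ¬ HasGenTorsion G} {H : Subgroup G} {hH : ∀ x ∈ H, ∀ y ∈ H, x * y = y * x}

lemma le_isolator : H ≤ isolator hG H hH := fun g hg => ⟨1, one_ne_zero, by simpa using hg⟩

lemma mem_isolator_of_zpow_mem {g : G} {n : ℤ} (hn : n ≠ 0) (h : g ^ n ∈ isolator hG H hH) :
    g ∈ isolator hG H hH := by
  obtain ⟨m, hm, h⟩ := h
  exact ⟨n * m, mul_ne_zero hn hm, by rwa [zpow_mul]⟩

lemma isolator_comm {x y : G} (hx : x ∈ isolator hG H hH) (hy : y ∈ isolator hG H hH) :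
    x * y = y * x := by
  obtain ⟨m, hm, hx⟩ := hx
  obtain ⟨n, hn, hy⟩ := hy
  exact commute_of_zpow_zpow hG hm hn (hH _ hx _ hy)

lemma conj_mem_isolator {k : G} (hk : ∀ x ∈ H, k * x * k⁻¹ ∈ isolator hG H hH) {g : G}
    (hg : g ∈ isolator hG H hH) : k * g * k⁻¹ ∈ isolator hG H hH := by
  obtain ⟨n, hn, hg⟩ := hg
  exact mem_isolator_of_zpow_mem hn (by simpa [conj_zpow] using hk _ hg)

end Isolator

end GenTorsion

section Gpq

variable {p q : ℤ}

/-- The homomorphism `G_{p,q} → ℤ` with `a, b ↦ 0` and `t ↦ 1`. -/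
def gpqHeight (p q : ℤ) : Gpq p q →* Multiplicative ℤ :=
  PresentedGroup.toGroup (f := ![1, 1, Multiplicative.ofAdd 1]) (by
    rintro _ (rfl | rfl | rfl) <;> simp)

lemma gpq_relations (p q : ℤ) :
    let a : Gpq p q := PresentedGroup.of 0
    let b : Gpq p q := PresentedGroup.of 1
    let t : Gpq p q := PresentedGroup.of 2
    t * a ^ p * t⁻¹ = b⁻¹ * a ^ p ∧ t * b ^ (-q) * a⁻¹ * t⁻¹ = b ^ (-q) ∧
      Commute (a ^ p) (b ^ q) := by
  have h : ∀ w ∈ gpqRels p q, PresentedGroup.mk (gpqRels p q) w = 1 := fun w hw =>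
    PresentedGroup.one_of_mem hw
  have h₁ := h _ (.inl rfl)
  have h₂ := h _ (.inr (.inl rfl))
  have h₃ := h _ (.inr (.inr rfl))
  simp only [map_mul, map_inv, map_zpow] at h₁ h₂ h₃
  refine ⟨mul_inv_eq_one.1 h₁, mul_inv_eq_one.1 h₂, ?_⟩
  rw [mul_assoc, ← mul_inv_rev, inv_mul_eq_one] at h₃
  exact h₃

lemma gpqHeight_ker_comm (hp : p ≠ 0) (hq : q ≠ 0) (hG : ¬ HasGenTorsion (Gpq p q)) :
    ∀ x ∈ (gpqHeight p q).ker, ∀ y ∈ (gpqHeight p q).ker, x * y = y * x := by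
  obtain ⟨h₁, h₂, h₃⟩ := gpq_relations p q
  set a : Gpq p q := PresentedGroup.of 0
  set b : Gpq p q := PresentedGroup.of 1
  set t : Gpq p q := PresentedGroup.of 2 with ht
  have hab : Commute a b := commute_of_zpow_zpow hG hp hq h₃
  have hH : ∀ x ∈ Subgroup.closure {a, b}, ∀ y ∈ Subgroup.closure {a, b}, x * y = y * x := by
    intro x hx y hy
    have := Subgroup.isMulCommutative_closure (k := ({a, b} : Set (Gpq p q))) (by
      rintro x (rfl | rfl) y (rfl | rfl)
      exacts [rfl, hab, hab.symm, rfl])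
    exact congrArg Subtype.val (this.is_comm.comm ⟨x, hx⟩ ⟨y, hy⟩)
  set I := isolator hG _ hH
  have haI : a ∈ I := le_isolator (Subgroup.subset_closure (.inl rfl))
  have hbI : b ∈ I := le_isolator (Subgroup.subset_closure (.inr rfl))
  have conj : ∀ k : Gpq p q, k * a * k⁻¹ ∈ I → k * b * k⁻¹ ∈ I → ∀ g ∈ I, k * g * k⁻¹ ∈ I := by
    intro k hka hkb g hg
    refine conj_mem_isolator (fun x hx => ?_) hg
    have : Subgroup.closure {a, b} ≤ I.comap (MulAut.conj k).toMonoidHom := by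
      rw [Subgroup.closure_le]
      rintro y (rfl | rfl)
      exacts [hka, hkb]
    exact this hx
  have hta : t * a * t⁻¹ ∈ I := by
    refine mem_isolator_of_zpow_mem hp ?_
    rw [conj_zpow, h₁]
    exact I.mul_mem (I.inv_mem hbI) (I.zpow_mem haI p)
  have htb : t * b * t⁻¹ ∈ I := by
    refine mem_isolator_of_zpow_mem (neg_ne_zero.2 hq) ?_
    have : (t * b * t⁻¹) ^ (-q) = b ^ (-q) * (t * a * t⁻¹) := by
      rw [conj_zpow]
      nth_rewrite 2 [← h₂]
      group
    rw [this]
    exact I.mul_mem (I.zpow_mem hbI _) hta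
  have htb' : t⁻¹ * b * t⁻¹⁻¹ ∈ I := by
    refine mem_isolator_of_zpow_mem (neg_ne_zero.2 hq) ?_
    have : (t⁻¹ * b * t⁻¹⁻¹) ^ (-q) = b ^ (-q) * a⁻¹ := by
      rw [conj_zpow]
      nth_rewrite 1 [← h₂]
      group
    rw [this]
    exact I.mul_mem (I.zpow_mem hbI _) (I.inv_mem haI)
  have hta' : t⁻¹ * a * t⁻¹⁻¹ ∈ I := by
    refine mem_isolator_of_zpow_mem hp ?_
    have : (t⁻¹ * a * t⁻¹⁻¹) ^ p = (t⁻¹ * b * t⁻¹⁻¹) * a ^ p := by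
      have h : a ^ p = b * (t * a ^ p * t⁻¹) := by rw [h₁]; group
      rw [conj_zpow]
      nth_rewrite 1 [h]
      group
    rw [this]
    exact I.mul_mem htb' (I.zpow_mem haI _)
  have hIconj : ∀ k ∈ I, ∀ g ∈ I, k * g * k⁻¹ ∈ I := fun k hk g hg =>
    I.mul_mem (I.mul_mem hk hg) (I.inv_mem hk)
  have hnormal : I.Normal := by
    have htop : Subgroup.normalizer (I : Set (Gpq p q)) = ⊤ := by
      rw [eq_top_iff, ← PresentedGroup.closure_range_of, Subgroup.closure_le]
      rintro _ ⟨i, rfl⟩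
      have hmem : ∀ k : Gpq p q, (∀ g ∈ I, k * g * k⁻¹ ∈ I) → (∀ g ∈ I, k⁻¹ * g * k⁻¹⁻¹ ∈ I) →
          k ∈ Subgroup.normalizer (I : Set (Gpq p q)) := fun k hk hk' => by
        refine Subgroup.mem_normalizer_iff.2 fun g => ⟨hk g, fun h => ?_⟩
        convert hk' _ h using 1
        group
      fin_cases i
      · exact hmem a (hIconj a haI) (hIconj _ (I.inv_mem haI))
      · exact hmem b (hIconj b hbI) (hIconj _ (I.inv_mem hbI))
      · exact hmem t (conj t hta htb) (conj t⁻¹ hta' htb')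
    exact Subgroup.normalizer_eq_top_iff.1 htop
  have hquot : ∀ g : Gpq p q, (g : Gpq p q ⧸ I) = (t : Gpq p q ⧸ I) ^ (gpqHeight p q g).toAdd := by
    have : QuotientGroup.mk' I =
        (zpowersHom (Gpq p q ⧸ I) (t : Gpq p q ⧸ I)).comp (gpqHeight p q) := by
      refine PresentedGroup.ext fun i => ?_
      fin_cases i
      · simpa [gpqHeight] using haI
      · simpa [gpqHeight] using hbI
      · simp [gpqHeight, ht]
    exact fun g => DFunLike.congr_fun this g
  have hker : ∀ x ∈ (gpqHeight p q).ker, x ∈ I := fun x hx => by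
    rw [← QuotientGroup.eq_one_iff, hquot, MonoidHom.mem_ker.1 hx]
    simp
  exact fun x hx y hy => isolator_comm (hker x hx) (hker y hy)

end Gpq

/-- `G_{p,q}` is bi-orderable iff it admits no generalized torsion elements. -/
theorem biOrderable_iff_not_hasGenTorsion (p q : ℤ) (hp : p ≠ 0) (hq : q ≠ 0) :
    IsBiOrderable (Gpq p q) ↔ ¬ HasGenTorsion (Gpq p q) :=
  ⟨IsBiOrderable.not_hasGenTorsion, fun hG =>
    isBiOrderable_of_ker_comm hG (gpqHeight p q) (gpqHeight_ker_comm hp hq hG)⟩
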